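/- Let X be a compact metric space and f : X → X a homeomorphism with finite non-wandering set. Then for all n ≥ 2, h_pol(F_n(f)) = n · h_pol(f), where F_n(f) is the induced map on the n-fold symmetric product. -/

import Mathlib

open Filter Topology Set

section PolEnt

variable {X : Type*} [MetricSpace X]

/-- `E` is `(n,ε)`-separated for the dynamic metric of `f`. -/
def IsDynSep (f : X → X) (n : ℕ) (ε : ℝ) (E : Set X) : Prop :=
  ∀ x ∈ E, ∀ y ∈ E, x ≠ y → ∃ j < n, ε ≤ dist (f^[j] x) (f^[j] y)

/-- Maximal cardinality of an `(n,ε)`-separated set contained in `Y`. -/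
noncomputable def dynSepMax (f : X → X) (Y : Set X) (n : ℕ) (ε : ℝ) : ℕ :=
  sSup {k | ∃ E : Finset X, ↑E ⊆ Y ∧ IsDynSep f n ε ↑E ∧ E.card = k}

/-- Polynomial entropy of `f` on the set `Y`:
`lim_{ε→0} limsup_n log S(n,ε;Y)/log n`, expressed as a supremum over `ε > 0`
(the function is antitone in `ε`, so the limit as `ε → 0⁺` is this supremum). -/
noncomputable def polEntropyOn (f : X → X) (Y : Set X) : ENNReal :=
  ⨆ (ε : ℝ) (_ : 0 < ε),
    Filter.limsup (fun n : ℕ =>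
      ENNReal.ofReal (Real.log (dynSepMax f Y n ε) / Real.log n)) Filter.atTop

/-- Polynomial entropy of `f`. -/
noncomputable def polEntropy (f : X → X) : ENNReal := polEntropyOn f Set.univ

end PolEnt
open TopologicalSpace

/-- The `n`-fold symmetric product: nonempty subsets of `X` with at most `n` points,
viewed inside the hyperspace of nonempty compact subsets with the Hausdorff metric. -/
def symProd (X : Type*) [MetricSpace X] (n : ℕ) : Set (NonemptyCompacts X) :=
  {A | (A : Set X).Finite ∧ (A : Set X).ncard ≤ n}

/-- The induced map `F_n(f)` on the symmetric product, `A ↦ f(A)`. -/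
noncomputable def symProdMap {X : Type*} [MetricSpace X] {f : X → X} (hf : Continuous f)
    (n : ℕ) (A : symProd X n) : symProd X n :=
  ⟨⟨⟨f '' (A : Set X), (A.1.isCompact.image hf)⟩, A.1.nonempty.image f⟩,
    A.2.1.image f, (Set.ncard_image_le A.2.1).trans A.2.2⟩


/-- The set of non-wandering points of `f`. -/
def nonWanderingSet {X : Type*} [TopologicalSpace X] (f : X → X) : Set X :=
  {x | ∀ U ∈ nhds x, ∃ n, 1 ≤ n ∧ ((f^[n]) '' U ∩ U).Nonempty}

section DynSep

variable {Y : Type*} [MetricSpace Y]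

theorem IsDynSep.card_le_dynSepMax {g : Y → Y} {N K : ℕ} {ε : ℝ}
    (hK : ∀ E : Finset Y, IsDynSep g N ε ↑E → E.card ≤ K) {E : Finset Y}
    (hE : IsDynSep g N ε ↑E) : E.card ≤ dynSepMax g univ N ε :=
  le_csSup ⟨K, by rintro _ ⟨E, -, hE, rfl⟩; exact hK E hE⟩ ⟨E, subset_univ _, hE, rfl⟩

/-- If separated sets have bounded cardinality, one of maximal cardinality exists, and it is
spanning for the dynamic metric. -/
theorem exists_isDynSep_card_eq_dynSepMax {g : Y → Y} {N K : ℕ} {ε : ℝ} (hε : 0 < ε)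
    (hK : ∀ E : Finset Y, IsDynSep g N ε ↑E → E.card ≤ K) :
    ∃ E : Finset Y, IsDynSep g N ε ↑E ∧ E.card = dynSepMax g univ N ε ∧
      ∀ x, ∃ e ∈ E, ∀ j < N, dist (g^[j] x) (g^[j] e) < ε := by
  classical
  obtain ⟨E, -, hE, hcard⟩ := Nat.sSup_mem
      (s := {k | ∃ E : Finset Y, ↑E ⊆ (univ : Set Y) ∧ IsDynSep g N ε ↑E ∧ E.card = k})
      ⟨0, ∅, by simp, by simp [IsDynSep], rfl⟩
      ⟨K, by rintro _ ⟨E, -, hE, rfl⟩; exact hK E hE⟩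
  change E.card = dynSepMax g univ N ε at hcard
  refine ⟨E, hE, hcard, fun x => ?_⟩
  by_contra! hx
  have hxE : x ∉ E := fun h => by
    obtain ⟨j, -, hj⟩ := hx x h
    rw [dist_self] at hj
    linarith
  have hins : IsDynSep g N ε ↑(insert x E) := by
    intro a ha b hb hab
    rw [Finset.coe_insert] at ha hb
    rcases ha with rfl | ha <;> rcases hb with rfl | hb
    · exact absurd rfl hab
    · exact hx b hb
    · obtain ⟨j, hj, h⟩ := hx a ha
      exact ⟨j, hj, by rwa [dist_comm]⟩
    · exact hE a ha b hb hab
  have := hins.card_le_dynSepMax hK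
  rw [Finset.card_insert_of_notMem hxE] at this
  omega

theorem exists_card_le_of_isDynSep [CompactSpace Y] {g : Y → Y} (hg : Continuous g) (N : ℕ)
    {ε : ℝ} (hε : 0 < ε) : ∃ K, ∀ E : Finset Y, IsDynSep g N ε ↑E → E.card ≤ K := by
  let V : Y → Set Y := fun x => {y | ∀ j < N, dist (g^[j] y) (g^[j] x) < ε / 2}
  have hV : ∀ x ∈ (univ : Set Y), V x ∈ 𝓝 x := fun x _ => by
    have : ∀ᶠ y in 𝓝 x, ∀ j ∈ Iio N, dist (g^[j] y) (g^[j] x) < ε / 2 :=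
      (eventually_all_finite (finite_Iio N)).2 fun j _ =>
        (hg.iterate j).continuousAt.eventually (Metric.ball_mem_nhds _ (half_pos hε))
    exact this
  obtain ⟨T, -, hT⟩ := isCompact_univ.elim_nhds_subcover V hV
  choose c hcT hc using fun x => mem_iUnion₂.1 (hT (mem_univ x))
  refine ⟨T.card, fun E hE => Finset.card_le_card_of_injOn c (fun x _ => hcT x) ?_⟩
  intro x hx y hy hxy
  by_contra hne
  obtain ⟨j, hj, h⟩ := hE x hx y hy hne
  have h1 := hc x j hj
  have h2 := hc y j hj
  rw [← hxy] at h2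
  linarith [dist_triangle_right (g^[j] x) (g^[j] y) (g^[j] (c x))]

end DynSep

section NonWandering

variable {X : Type*}

theorem apply_mem_nonWanderingSet [TopologicalSpace X] {f : X → X} (hf : Continuous f) {x : X}
    (hx : x ∈ nonWanderingSet f) : f x ∈ nonWanderingSet f := by
  intro U hU
  obtain ⟨k, hk, _, ⟨y, hy, rfl⟩, hy'⟩ := hx _ (hf.continuousAt hU)
  refine ⟨k, hk, f (f^[k] y), ⟨f y, hy, ?_⟩, hy'⟩
  rw [← Function.iterate_succ_apply, Function.iterate_succ_apply']

/-- Orbits spend uniformly bounded time outside a neighbourhood of the non-wandering set. -/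
theorem exists_card_filter_iterate_notMem_le [TopologicalSpace X] [CompactSpace X] (f : X → X)
    {U : Set X} (hU : IsOpen U) (hMU : nonWanderingSet f ⊆ U) :
    ∃ K, ∀ (x : X) (J : Finset ℕ), (∀ j ∈ J, f^[j] x ∉ U) → J.card ≤ K := by
  have hw : ∀ x, ∃ V ∈ 𝓝 x, x ∈ Uᶜ → ∀ k, 1 ≤ k → ¬ ((f^[k]) '' V ∩ V).Nonempty := by
    intro x
    by_cases hx : x ∈ U
    · exact ⟨univ, univ_mem, fun h => absurd hx h⟩
    · have : x ∉ nonWanderingSet f := fun h => hx (hMU h)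
      simp only [nonWanderingSet, mem_ofPred_eq, not_forall, not_exists, not_and] at this
      obtain ⟨V, hV, h⟩ := this
      exact ⟨V, hV, fun _ => h⟩
  choose V hV hVw using hw
  obtain ⟨T, hTU, hT⟩ := hU.isClosed_compl.isCompact.elim_nhds_subcover V fun x _ => hV x
  refine ⟨T.card, fun x J hJ => ?_⟩
  have hc : ∀ j, ∃ z, j ∈ J → z ∈ T ∧ f^[j] x ∈ V z := fun j => by
    by_cases hj : j ∈ J
    · obtain ⟨z, hz, h⟩ := mem_iUnion₂.1 (hT (hJ j hj))
      exact ⟨z, fun _ => ⟨hz, h⟩⟩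
    · exact ⟨x, fun h => absurd h hj⟩
  choose c hc using hc
  have key : ∀ i ∈ J, ∀ j ∈ J, c i = c j → ¬ i < j := by
    intro i hi j hj hij hlt
    refine hVw (c i) (hTU _ (hc i hi).1) (j - i) (by omega)
      ⟨f^[j] x, ⟨f^[i] x, (hc i hi).2, ?_⟩, hij ▸ (hc j hj).2⟩
    rw [← Function.iterate_add_apply, Nat.sub_add_cancel hlt.le]
  refine Finset.card_le_card_of_injOn c (fun j hj => (hc j hj).1) fun i hi j hj hij => ?_
  have h1 := key i hi j hj hij
  have h2 := key j hj i hi hij.symm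
  omega

variable [MetricSpace X]

/-- A neighbourhood of a finite invariant set can be taken so thin that an orbit segment staying
in it follows the orbit of a single point of the set. -/
theorem exists_radius_of_finite_invariant [CompactSpace X] {f : X → X} (hf : Continuous f)
    {M : Set X} (hM : M.Finite) (hinv : ∀ p ∈ M, f p ∈ M) {ε : ℝ} (hε : 0 < ε) :
    ∃ s, 0 < s ∧ 2 * s ≤ ε ∧ ∀ x, ∀ p ∈ M, ∀ q ∈ M, dist x p < s → dist (f x) q < s → q = f p := by
  obtain ⟨η, hη, hsep⟩ : ∃ η > 0, ∀ p ∈ M, ∀ q ∈ M, dist p q < η → p = q := by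
    have : ∀ᶠ η in 𝓝[>] (0 : ℝ), ∀ p ∈ M, ∀ q ∈ M, dist p q < η → p = q := by
      refine (eventually_all_finite hM).2 fun p _ => (eventually_all_finite hM).2 fun q _ => ?_
      by_cases hpq : p = q
      · simp [hpq]
      · filter_upwards [Ioo_mem_nhdsGT (dist_pos.2 hpq)] with η hη h
        exact absurd h (not_lt.2 hη.2.le)
    obtain ⟨η, h, hη⟩ := (this.and self_mem_nhdsWithin).exists
    exact ⟨η, hη, h⟩
  obtain ⟨t, ht, hunif⟩ := Metric.uniformContinuous_iff.1
    (CompactSpace.uniformContinuous_of_continuous hf) (η / 2) (half_pos hη)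
  refine ⟨min t (min (η / 2) (ε / 2)), by positivity, ?_, ?_⟩
  · linarith [min_le_right t (min (η / 2) (ε / 2)), min_le_right (η / 2) (ε / 2)]
  · intro x p hp q hq hxp hxq
    refine hsep q hq _ (hinv p hp) ?_
    have h1 := hunif (hxp.trans_le (min_le_left _ _))
    have h2 := hxq.trans_le ((min_le_right _ _).trans (min_le_left _ _))
    linarith [dist_triangle_left q (f p) (f x)]

/-- If every point of a separated set is shadowed, at each time, by some point of a set of at most
`n` points, then the separated set has bounded cardinality, uniformly in time. -/
theorem exists_card_le_of_shadowed [CompactSpace X] {f : X → X} (hf : Continuous f)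
    (hfin : (nonWanderingSet f).Finite) {n : ℕ} (hn : 1 ≤ n) {ε : ℝ} (hε : 0 < ε) :
    ∃ δ > 0, ∃ C : ℕ, ∀ (N : ℕ) (A E : Finset X), A.card ≤ n → A.Nonempty →
      IsDynSep f N ε ↑E →
      (∀ b ∈ E, ∀ j < N, ∃ a ∈ A, dist (f^[j] b) (f^[j] a) < δ) → E.card ≤ C := by
  classical
  set M := nonWanderingSet f
  obtain ⟨s, hs, hsε, hfollow⟩ := exists_radius_of_finite_invariant hf hfin
    (fun p hp => apply_mem_nonWanderingSet hf hp) hε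
  let U : Set X := ⋃ p ∈ M, Metric.ball p (s / 2)
  obtain ⟨K, hK⟩ := exists_card_filter_iterate_notMem_le f (U := U)
    (isOpen_biUnion fun _ _ => Metric.isOpen_ball)
    (fun p hp => mem_biUnion hp (Metric.mem_ball_self (half_pos hs)))
  refine ⟨s / 2, half_pos hs, n ^ (2 * (n * K) + 1), ?_⟩
  intro N A E hAn hA hE hsh
  obtain ⟨a₀, ha₀⟩ := hA
  have hc : ∀ b j, ∃ a : A, b ∈ E → j < N → dist (f^[j] b) (f^[j] (a : X)) < s / 2 := by
    intro b j
    by_cases h : b ∈ E ∧ j < N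
    · obtain ⟨a, ha, hd⟩ := hsh b h.1 j h.2
      exact ⟨⟨a, ha⟩, fun _ _ => hd⟩
    · exact ⟨⟨a₀, ha₀⟩, fun h1 h2 => absurd ⟨h1, h2⟩ h⟩
  choose c hc using hc
  let J : Finset ℕ := A.biUnion fun a => {j ∈ Finset.range N | f^[j] a ∉ U}
  have hJ : J.card ≤ n * K :=
    (Finset.card_biUnion_le_card_mul _ _ K fun a _ =>
      hK a _ fun j hj => (Finset.mem_filter.1 hj).2).trans (Nat.mul_le_mul_right _ hAn)
  let J' : Finset ℕ := insert 0 (J ∪ J.image Nat.succ)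
  have hJ' : J'.card ≤ 2 * (n * K) + 1 := by
    have h1 := Finset.card_insert_le 0 (J ∪ J.image Nat.succ)
    have h2 := Finset.card_union_le J (J.image Nat.succ)
    have h3 : (J.image Nat.succ).card ≤ J.card := Finset.card_image_le
    change (insert 0 (J ∪ J.image Nat.succ)).card ≤ _
    omega
  have hgood : ∀ j < N, j ∉ J → ∀ a : A, ∃ p ∈ M, dist (f^[j] (a : X)) p < s / 2 := by
    intro j hj hjJ a
    by_contra hcon
    refine hjJ (Finset.mem_biUnion.2 ⟨a, a.2, Finset.mem_filter.2
      ⟨Finset.mem_range.2 hj, fun hU => hcon ?_⟩⟩)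
    obtain ⟨p, hp, h⟩ := mem_iUnion₂.1 hU
    exact ⟨p, hp, h⟩
  have hnear : ∀ b ∈ E, ∀ j < N, ∀ p, dist (f^[j] (c b j : X)) p < s / 2 →
      dist (f^[j] b) p < s := fun b hb j hj p hp => by
    linarith [hc b j hb hj, dist_triangle (f^[j] b) (f^[j] (c b j : X)) p]
  let code : X → (J' → A) := fun b j => c b j
  have hinj : Set.InjOn code E := by
    intro b hb b' hb' hcode
    have hcode' : ∀ j ∈ J', c b j = c b' j := fun j hj => congrFun hcode ⟨j, hj⟩
    have hQ : ∀ j, j < N → j ∉ J → ∃ p ∈ M, dist (f^[j] b) p < s ∧ dist (f^[j] b') p < s := by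
      intro j
      induction j with
      | zero =>
        intro hj hjJ
        obtain ⟨p, hp, h⟩ := hgood 0 hj hjJ (c b 0)
        refine ⟨p, hp, hnear b hb 0 hj p h, hnear b' hb' 0 hj p ?_⟩
        rwa [← hcode' 0 (Finset.mem_insert_self _ _)]
      | succ k ih =>
        intro hj hjJ
        obtain ⟨q, hq, h⟩ := hgood _ hj hjJ (c b (k + 1))
        by_cases hk : k ∈ J
        · refine ⟨q, hq, hnear b hb _ hj q h, hnear b' hb' _ hj q ?_⟩
          rwa [← hcode' (k + 1) (Finset.mem_insert_of_mem
            (Finset.mem_union_right _ (Finset.mem_image_of_mem _ hk)))]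
        · obtain ⟨p, hp, h1, h2⟩ := ih (by omega) hk
          obtain ⟨q', hq', h'⟩ := hgood _ hj hjJ (c b' (k + 1))
          have e1 := hnear b hb _ hj q h
          have e2 := hnear b' hb' _ hj q' h'
          have hqp : q = f p := hfollow _ p hp q hq h1 (by rwa [← Function.iterate_succ_apply' f])
          have hqp' : q' = f p :=
            hfollow _ p hp q' hq' h2 (by rwa [← Function.iterate_succ_apply' f])
          exact ⟨q, hq, e1, by rwa [hqp, ← hqp']⟩
    by_contra hne
    obtain ⟨j, hj, hd⟩ := hE b hb b' hb' hne
    by_cases hjJ : j ∈ J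
    · have h1 := hc b j hb hj
      have h2 := hc b' j hb' hj
      rw [← hcode' j (Finset.mem_insert_of_mem (Finset.mem_union_left _ hjJ))] at h2
      linarith [dist_triangle_right (f^[j] b) (f^[j] b') (f^[j] (c b j : X))]
    · obtain ⟨p, -, h1, h2⟩ := hQ j hj hjJ
      linarith [dist_triangle_right (f^[j] b) (f^[j] b') p]
  calc E.card ≤ (Finset.univ : Finset (J' → A)).card :=
        Finset.card_le_card_of_injOn code (fun _ _ => Finset.mem_coe.2 (Finset.mem_univ _)) hinj
    _ = A.card ^ J'.card := by simp
    _ ≤ n ^ J'.card := Nat.pow_le_pow_left hAn _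
    _ ≤ n ^ (2 * (n * K) + 1) := Nat.pow_le_pow_right hn hJ'

end NonWandering

section SymProd

variable {X : Type*} [MetricSpace X]

theorem coe_iterate_symProdMap {f : X → X} (hf : Continuous f) {n : ℕ} (j : ℕ)
    (A : symProd X n) :
    ((((symProdMap hf n)^[j] A : symProd X n) : NonemptyCompacts X) : Set X) =
      f^[j] '' (A : NonemptyCompacts X) := by
  induction j with
  | zero => simp
  | succ k ih =>
    rw [Function.iterate_succ_apply', Function.iterate_succ', image_comp, ← ih]
    rfl

theorem exists_range_eq_of_symProd {n : ℕ} (A : symProd X n) :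
    ∃ g : Fin n → X, range g = (A : NonemptyCompacts X) := by
  obtain ⟨A, hA, hcard⟩ := A
  obtain ⟨a, ha⟩ := A.nonempty
  let s := hA.toFinset
  have hs : s.card ≤ n := by rwa [← ncard_eq_toFinset_card _ hA]
  let φ : Fin n → X := fun i => if h : (i : ℕ) < s.card then s.equivFin.symm ⟨i, h⟩ else a
  refine ⟨φ, Subset.antisymm ?_ ?_⟩
  · rintro _ ⟨i, rfl⟩
    by_cases h : (i : ℕ) < s.card
    · simp only [φ, h, dif_pos]
      exact hA.mem_toFinset.1 (s.equivFin.symm ⟨i, h⟩).2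
    · simp only [φ, h]
      exact ha
  · intro x hx
    have hxs : x ∈ s := hA.mem_toFinset.2 hx
    refine ⟨⟨s.equivFin ⟨x, hxs⟩, (s.equivFin ⟨x, hxs⟩).2.trans_le hs⟩, ?_⟩
    simp [φ]

/-- The point `{g 0, …, g (n - 1)}` of the symmetric product. -/
def symProdOfFun {n : ℕ} [NeZero n] (g : Fin n → X) : symProd X n :=
  ⟨⟨⟨range g, (finite_range g).isCompact⟩, range_nonempty g⟩, finite_range g, by
    change (range g).ncard ≤ n
    rw [← image_univ]
    simpa using ncard_image_le (f := g) finite_univ⟩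

theorem card_le_pow_of_isDynSep_symProdMap [CompactSpace X] {f : X → X} (hf : Continuous f)
    (n N : ℕ) {ε : ℝ} (hε : 0 < ε) (T : Finset (symProd X n))
    (hT : IsDynSep (symProdMap hf n) N ε ↑T) :
    T.card ≤ dynSepMax f univ N (ε / 3) ^ n := by
  classical
  have hε3 : 0 < ε / 3 := by positivity
  obtain ⟨K, hK⟩ := exists_card_le_of_isDynSep hf N hε3
  obtain ⟨E, -, hcard, hspan⟩ := exists_isDynSep_card_eq_dynSepMax hε3 hK
  choose e heE he using hspan
  choose g hg using fun A : symProd X n => exists_range_eq_of_symProd A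
  rw [← hcard]
  have hbound : T.card ≤ (Finset.univ : Finset (Fin n → E)).card := by
    refine Finset.card_le_card_of_injOn (fun A i => ⟨e (g A i), heE _⟩)
      (fun _ _ => Finset.mem_coe.2 (Finset.mem_univ _)) ?_
    intro A hA B hB hAB
    by_contra hne
    obtain ⟨j, hj, hd⟩ := hT A hA B hB hne
    have hclose : ∀ i, dist (f^[j] (g A i)) (f^[j] (g B i)) ≤ 2 * (ε / 3) := by
      intro i
      have hi : e (g A i) = e (g B i) := congrArg Subtype.val (congrFun hAB i)
      have h1 := he (g A i) j hj
      have h2 := he (g B i) j hj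
      rw [← hi] at h2
      linarith [dist_triangle_right (f^[j] (g A i)) (f^[j] (g B i)) (f^[j] (e (g A i)))]
    have : dist ((symProdMap hf n)^[j] A) ((symProdMap hf n)^[j] B) ≤ 2 * (ε / 3) := by
      rw [Subtype.dist_eq, Metric.NonemptyCompacts.dist_eq, coe_iterate_symProdMap,
        coe_iterate_symProdMap, ← hg, ← hg]
      refine Metric.hausdorffDist_le_of_mem_dist (by positivity) ?_ ?_
      · rintro _ ⟨_, ⟨i, rfl⟩, rfl⟩
        exact ⟨_, ⟨_, ⟨i, rfl⟩, rfl⟩, hclose i⟩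
      · rintro _ ⟨_, ⟨i, rfl⟩, rfl⟩
        exact ⟨_, ⟨_, ⟨i, rfl⟩, rfl⟩, by rw [dist_comm]; exact hclose i⟩
    linarith
  simpa using hbound

theorem dynSepMax_symProdMap_le [CompactSpace X] {f : X → X} (hf : Continuous f)
    (n N : ℕ) {ε : ℝ} (hε : 0 < ε) :
    dynSepMax (symProdMap hf n) univ N ε ≤ dynSepMax f univ N (ε / 3) ^ n := by
  obtain ⟨T, hT, hcard, -⟩ := exists_isDynSep_card_eq_dynSepMax hε
    (card_le_pow_of_isDynSep_symProdMap hf n N hε)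
  exact hcard ▸ card_le_pow_of_isDynSep_symProdMap hf n N hε T hT

theorem exists_dynSepMax_pow_le [CompactSpace X] {f : X → X} (hf : Continuous f)
    (hfin : (nonWanderingSet f).Finite) {n : ℕ} (hn : 1 ≤ n) {ε : ℝ} (hε : 0 < ε) :
    ∃ δ > 0, ∃ C : ℕ, ∀ N, dynSepMax f univ N ε ^ n ≤
      C * dynSepMax (symProdMap hf n) univ N δ := by
  classical
  have : NeZero n := ⟨by omega⟩
  obtain ⟨δ, hδ, C, hshadow⟩ := exists_card_le_of_shadowed hf hfin hn hε
  refine ⟨δ, hδ, C ^ n, fun N => ?_⟩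
  obtain ⟨K, hK⟩ := exists_card_le_of_isDynSep hf N hε
  obtain ⟨E, hE, hEcard, -⟩ := exists_isDynSep_card_eq_dynSepMax hε hK
  obtain ⟨T, -, hTcard, hspan⟩ := exists_isDynSep_card_eq_dynSepMax hδ
    (card_le_pow_of_isDynSep_symProdMap hf n N hδ)
  choose t htT ht using hspan
  let F : (Fin n → X) → symProd X n := fun g => t (symProdOfFun g)
  rw [← hEcard, ← hTcard]
  have hfiber : ∀ A ∈ T, {g ∈ Fintype.piFinset fun _ : Fin n => E | F g = A}.card ≤ C ^ n := by
    intro A _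
    let A' : Finset X := A.2.1.toFinset
    let B : Finset X := {b ∈ E | ∀ j < N, ∃ a ∈ A', dist (f^[j] b) (f^[j] a) < δ}
    have hB : B.card ≤ C := by
      refine hshadow N A' B ?_ ?_ ?_ fun b hb => (Finset.mem_filter.1 hb).2
      · rw [← ncard_eq_toFinset_card _ A.2.1]
        exact A.2.2
      · exact A.2.1.toFinset_nonempty.2 A.1.nonempty
      · intro x hx y hy
        exact hE x (Finset.mem_filter.1 hx).1 y (Finset.mem_filter.1 hy).1
    calc _ ≤ (Fintype.piFinset fun _ : Fin n => B).card := by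
          refine Finset.card_le_card fun g hg => ?_
          obtain ⟨hgE, hgA⟩ := Finset.mem_filter.1 hg
          rw [Fintype.mem_piFinset] at hgE ⊢
          refine fun i => Finset.mem_filter.2 ⟨hgE i, fun j hj => ?_⟩
          have hd := ht (symProdOfFun g) j hj
          change t (symProdOfFun g) = A at hgA
          rw [hgA, Subtype.dist_eq, Metric.NonemptyCompacts.dist_eq, coe_iterate_symProdMap,
            coe_iterate_symProdMap] at hd
          obtain ⟨_, ⟨a, ha, rfl⟩, h⟩ := Metric.exists_dist_lt_of_hausdorffDist_lt
            (mem_image_of_mem _ (mem_range_self i)) hd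
            (Metric.hausdorffEDist_ne_top_of_nonempty_of_bounded
              ((range_nonempty g).image _) (A.1.nonempty.image _)
              (Metric.isBounded_of_compactSpace) (Metric.isBounded_of_compactSpace))
          exact ⟨a, A.2.1.mem_toFinset.2 ha, h⟩
      _ = B.card ^ n := by simp
      _ ≤ C ^ n := Nat.pow_le_pow_left hB n
  have := Finset.card_le_mul_card_image_of_maps_to
    (s := Fintype.piFinset fun _ : Fin n => E) (t := T) (f := F) (fun g _ => htT _) (C ^ n) hfiber
  simpa using this

end SymProd

/-- Polynomial growth rate of a sequence of natural numbers. -/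
noncomputable def polGrowth (u : ℕ → ℕ) : ENNReal :=
  limsup (fun N : ℕ => ENNReal.ofReal (Real.log (u N) / Real.log N)) atTop

theorem polGrowth_le_of_le_pow {u v : ℕ → ℕ} {n : ℕ} (h : ∀ N, u N ≤ v N ^ n) :
    polGrowth u ≤ n * polGrowth v := by
  rw [polGrowth, polGrowth, ← ENNReal.limsup_const_mul_of_ne_top (ENNReal.natCast_ne_top n)]
  refine limsup_le_limsup (Eventually.of_forall fun N => ?_)
  dsimp only
  rw [← ENNReal.ofReal_natCast n, ← ENNReal.ofReal_mul n.cast_nonneg, ← mul_div_assoc]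
  refine ENNReal.ofReal_le_ofReal (div_le_div_of_nonneg_right ?_ (Real.log_natCast_nonneg N))
  rcases Nat.eq_zero_or_pos (u N) with h0 | h0
  · rw [h0, Nat.cast_zero, Real.log_zero]
    exact mul_nonneg n.cast_nonneg (Real.log_natCast_nonneg _)
  · rw [← Real.log_pow]
    exact Real.log_le_log (by exact_mod_cast h0) (by exact_mod_cast h N)

theorem mul_polGrowth_le_of_pow_le {u v : ℕ → ℕ} {n C : ℕ} (h : ∀ N, v N ^ n ≤ C * u N) :
    n * polGrowth v ≤ polGrowth u := by
  have hlim : Tendsto (fun N : ℕ => ENNReal.ofReal (Real.log C / Real.log N)) atTop (𝓝 0) := by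
    rw [← ENNReal.ofReal_zero]
    exact ENNReal.tendsto_ofReal
      ((Real.tendsto_log_atTop.comp tendsto_natCast_atTop_atTop).const_div_atTop _)
  rw [polGrowth, polGrowth, ← ENNReal.limsup_const_mul_of_ne_top (ENNReal.natCast_ne_top n)]
  calc _ ≤ limsup ((fun N : ℕ => ENNReal.ofReal (Real.log C / Real.log N)) +
        fun N : ℕ => ENNReal.ofReal (Real.log (u N) / Real.log N)) atTop := by
        refine limsup_le_limsup (Eventually.of_forall fun N => ?_)
        dsimp only [Pi.add_apply]
        rw [← ENNReal.ofReal_natCast n, ← ENNReal.ofReal_mul n.cast_nonneg,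
          ← ENNReal.ofReal_add (div_nonneg (Real.log_natCast_nonneg _) (Real.log_natCast_nonneg _))
            (div_nonneg (Real.log_natCast_nonneg _) (Real.log_natCast_nonneg _)),
          ← mul_div_assoc, ← add_div]
        refine ENNReal.ofReal_le_ofReal (div_le_div_of_nonneg_right ?_ (Real.log_natCast_nonneg N))
        have hnonneg := add_nonneg (Real.log_natCast_nonneg C) (Real.log_natCast_nonneg (u N))
        rcases Nat.eq_zero_or_pos (v N) with h0 | h0
        · rw [h0, Nat.cast_zero, Real.log_zero, mul_zero]
          exact hnonneg
        · have hpos : 0 < C * u N := (pow_pos h0 n).trans_le (h N)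
          have hC : (C : ℝ) ≠ 0 := by exact_mod_cast (Nat.pos_of_mul_pos_right hpos).ne'
          have hu : (u N : ℝ) ≠ 0 := by exact_mod_cast (Nat.pos_of_mul_pos_left hpos).ne'
          rw [← Real.log_pow, ← Real.log_mul hC hu]
          exact Real.log_le_log (by positivity) (by exact_mod_cast h N)
    _ ≤ _ := (ENNReal.limsup_add_of_left_tendsto_zero hlim _).le

/-- Main theorem (symmetric product part): for a homeomorphism `f` of a compact metric
space with finite non-wandering set and `n ≥ 2`, `h_pol(F_n(f)) = n · h_pol(f)`. -/
theorem polEntropy_symProdMap {X : Type*} [MetricSpace X] [CompactSpace X]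
    (f : X ≃ₜ X) (hfin : (nonWanderingSet (f : X → X)).Finite)
    (n : ℕ) (hn : 2 ≤ n) :
    polEntropy (symProdMap f.continuous n) = n * polEntropy (f : X → X) := by
  rw [polEntropy, polEntropy, polEntropyOn, polEntropyOn]
  apply le_antisymm
  · refine iSup₂_le fun ε hε =>
      (polGrowth_le_of_le_pow fun N => dynSepMax_symProdMap_le f.continuous n N hε).trans ?_
    gcongr
    exact le_iSup₂_of_le (ε / 3) (by positivity) le_rfl
  · simp only [ENNReal.mul_iSup]
    refine iSup₂_le fun ε hε => ?_
    obtain ⟨δ, hδ, C, h⟩ := exists_dynSepMax_pow_le f.continuous hfin (by omega : 1 ≤ n) hε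
    exact (mul_polGrowth_le_of_pow_le h).trans (le_iSup₂_of_le δ hδ le_rfl)
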